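/- Let d ≥ 3 and let a, b : ℝ^d → ℝ be measurable functions satisfying |a(x)| ≤ M|x|^{−1}, |b(x)| ≤ M|x|^{−1} for x ≠ 0. Then for every t > 0, (e^{tΔ}a)(e^{tΔ}b) = e^{tΔ}(ab) − 2∫₀^t e^{(t−s)Δ}[∇e^{sΔ}a · ∇e^{sΔ}b] ds, where the equality holds pointwise on ℝ^d. -/

import Mathlib

open scoped BigOperators

/-- Partial derivative in direction `i`. -/
noncomputable def pd {d : ℕ} (i : Fin d) (f : EuclideanSpace ℝ (Fin d) → ℝ) :
    EuclideanSpace ℝ (Fin d) → ℝ :=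
  fun x => fderiv ℝ f x (EuclideanSpace.single i 1)

/-- The heat kernel `g_t(y) = (4πt)^{−d/2} e^{−|y|²/(4t)}` on `ℝ^d`. -/
noncomputable def heatKernel (d : ℕ) (t : ℝ) (y : EuclideanSpace ℝ (Fin d)) : ℝ :=
  (4 * Real.pi * t) ^ (-(d : ℝ) / 2) * Real.exp (-‖y‖ ^ 2 / (4 * t))

/-- The heat semigroup `e^{tΔ}a = g_t * a`. -/
noncomputable def heat (d : ℕ) (t : ℝ) (a : EuclideanSpace ℝ (Fin d) → ℝ) :
    EuclideanSpace ℝ (Fin d) → ℝ :=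
  fun x => ∫ y : EuclideanSpace ℝ (Fin d), heatKernel d t (x - y) * a y

open MeasureTheory Set Filter Topology

/-- The Gaussian weight `e^{-c|y|²}` is integrable. -/
lemma integrable_exp_neg_mul_norm_sq {d : ℕ} {c : ℝ} (hc : 0 < c) :
    Integrable (fun y : EuclideanSpace ℝ (Fin d) => Real.exp (-c * ‖y‖ ^ 2)) := by
  refine Integrable.of_integral_ne_zero ?_
  rw [GaussianFourier.integral_rexp_neg_mul_sq_norm hc]
  positivity

lemma heatKernel_nonneg {d : ℕ} {t : ℝ} (ht : 0 ≤ t) (y : EuclideanSpace ℝ (Fin d)) :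
    0 ≤ heatKernel d t y := by
  unfold heatKernel; positivity

lemma heatKernel_neg {d : ℕ} (t : ℝ) (y : EuclideanSpace ℝ (Fin d)) :
    heatKernel d t (-y) = heatKernel d t y := by
  simp [heatKernel]

lemma heatKernel_sub_comm {d : ℕ} (t : ℝ) (y z : EuclideanSpace ℝ (Fin d)) :
    heatKernel d t (y - z) = heatKernel d t (z - y) := by
  rw [← heatKernel_neg, neg_sub]

lemma continuous_heatKernel {d : ℕ} (t : ℝ) : Continuous (heatKernel d t) := by
  unfold heatKernel; fun_prop

lemma heatKernel_eq {d : ℕ} (t : ℝ) (y : EuclideanSpace ℝ (Fin d)) :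
    heatKernel d t y =
      (4 * Real.pi * t) ^ (-(d : ℝ) / 2) * Real.exp (-(1 / (4 * t)) * ‖y‖ ^ 2) := by
  unfold heatKernel; congr 2; ring

lemma integrable_heatKernel {d : ℕ} {t : ℝ} (ht : 0 < t) : Integrable (heatKernel d t) := by
  have h := (integrable_exp_neg_mul_norm_sq (d := d) (c := 1 / (4 * t)) (by positivity)).const_mul
    ((4 * Real.pi * t) ^ (-(d : ℝ) / 2))
  exact h.congr (.of_forall fun y => (heatKernel_eq t y).symm)

lemma integral_heatKernel {d : ℕ} {t : ℝ} (ht : 0 < t) : ∫ y, heatKernel d t y = 1 := by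
  simp_rw [heatKernel_eq, integral_const_mul]
  rw [GaussianFourier.integral_rexp_neg_mul_sq_norm (by positivity)]
  have h : Real.pi / (1 / (4 * t)) = 4 * Real.pi * t := by field_simp
  rw [h, ← Real.rpow_add (by positivity)]
  simp [neg_div]

/-- The heat kernel at times in `[r, R]` is dominated by one Gaussian. -/
lemma heatKernel_le {d : ℕ} {r R s : ℝ} (hr : 0 < r) (hrs : r ≤ s) (hsR : s ≤ R)
    (y : EuclideanSpace ℝ (Fin d)) :
    heatKernel d s y ≤
      (4 * Real.pi * r) ^ (-(d : ℝ) / 2) * Real.exp (-(1 / (4 * R)) * ‖y‖ ^ 2) := by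
  have hs : 0 < s := hr.trans_le hrs
  rw [heatKernel_eq]
  have h1 : (4 * Real.pi * s) ^ (-(d : ℝ) / 2) ≤ (4 * Real.pi * r) ^ (-(d : ℝ) / 2) := by
    apply Real.rpow_le_rpow_of_nonpos (by positivity) (by gcongr)
    have : (0 : ℝ) ≤ d := by positivity
    linarith
  have h2 : 1 / (4 * R) ≤ 1 / (4 * s) := by gcongr
  gcongr

/-- The product of two heat kernels, after completing the square. -/
lemma heatKernel_mul_heatKernel {d : ℕ} {p q : ℝ} (hp : 0 < p) (hq : 0 < q)
    (u w : EuclideanSpace ℝ (Fin d)) :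
    heatKernel d p (u - w) * heatKernel d q w =
      heatKernel d (p + q) u * heatKernel d (p * q / (p + q)) (w - (q / (p + q)) • u) := by
  unfold heatKernel
  have hpq : 0 < p + q := by positivity
  rw [mul_mul_mul_comm, mul_mul_mul_comm ((4 * Real.pi * (p + q)) ^ (-(d : ℝ) / 2)),
    ← Real.mul_rpow (by positivity) (by positivity),
    ← Real.mul_rpow (by positivity) (by positivity), ← Real.exp_add, ← Real.exp_add]
  congr 2
  · field_simp
  · rw [norm_sub_sq_real, norm_sub_sq_real, inner_smul_right, norm_smul, mul_pow, Real.norm_eq_abs,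
      sq_abs, real_inner_comm w u]
    field_simp
    ring

/-- The semigroup property of the heat kernel. -/
lemma integral_heatKernel_mul_heatKernel {d : ℕ} {p q : ℝ} (hp : 0 < p) (hq : 0 < q)
    (u : EuclideanSpace ℝ (Fin d)) :
    ∫ w, heatKernel d p (u - w) * heatKernel d q w = heatKernel d (p + q) u := by
  simp_rw [heatKernel_mul_heatKernel hp hq, integral_const_mul]
  rw [integral_sub_right_eq_self (heatKernel d (p * q / (p + q))),
    integral_heatKernel (by positivity), mul_one]

/-- The time derivative of the heat kernel. -/
lemma hasDerivAt_heatKernel {d : ℕ} {t : ℝ} (ht : 0 < t) (y : EuclideanSpace ℝ (Fin d)) :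
    HasDerivAt (fun s => heatKernel d s y)
      ((‖y‖ ^ 2 / (4 * t ^ 2) - d / (2 * t)) * heatKernel d t y) t := by
  unfold heatKernel
  have h1 : HasDerivAt (fun s : ℝ => 4 * Real.pi * s) (4 * Real.pi) t := by
    simpa using (hasDerivAt_id t).const_mul (4 * Real.pi)
  have h2 := h1.rpow_const (p := -(d : ℝ) / 2) (Or.inl (by positivity))
  have h3 : HasDerivAt (fun s : ℝ => -‖y‖ ^ 2 / (4 * s)) (‖y‖ ^ 2 / (4 * t ^ 2)) t := by
    have h4 : HasDerivAt (fun s : ℝ => 4 * s) 4 t := by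
      simpa using (hasDerivAt_id t).const_mul (4 : ℝ)
    refine ((hasDerivAt_const t (-‖y‖ ^ 2)).div h4 (by positivity)).congr_deriv ?_
    field_simp
    ring
  refine (h2.mul h3.exp).congr_deriv ?_
  rw [Real.rpow_sub_one (by positivity)]
  field_simp
  ring

lemma mul_exp_neg_mul_le {c : ℝ} (hc : 0 < c) (r : ℝ) :
    r * Real.exp (-c * r) ≤ 2 / c * Real.exp (-(c / 2) * r) := by
  have h1 : -c * r = -(c / 2) * r + -(c / 2) * r := by ring
  rw [h1, Real.exp_add, ← mul_assoc]
  gcongr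
  have h2 := Real.add_one_le_exp (c / 2 * r)
  rw [neg_mul, Real.exp_neg, ← div_eq_mul_inv, div_le_div_iff₀ (Real.exp_pos _) hc]
  nlinarith

/-- The time derivative of the heat kernel at times in `[r, R]` is dominated by one Gaussian. -/
lemma exists_abs_deriv_heatKernel_le (d : ℕ) {r R : ℝ} (hr : 0 < r) (hrR : r ≤ R) :
    ∃ C : ℝ, 0 ≤ C ∧ ∀ s ∈ Icc r R, ∀ y : EuclideanSpace ℝ (Fin d),
      |(‖y‖ ^ 2 / (4 * s ^ 2) - d / (2 * s)) * heatKernel d s y| ≤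
        C * Real.exp (-(1 / (8 * R)) * ‖y‖ ^ 2) := by
  have hR : 0 < R := hr.trans_le hrR
  set A : ℝ := (4 * Real.pi * r) ^ (-(d : ℝ) / 2) with hA
  have hA0 : 0 ≤ A := by positivity
  refine ⟨A * (1 / (4 * r ^ 2) * (2 / (1 / (4 * R))) + d / (2 * r)), by positivity, ?_⟩
  rintro s ⟨hrs, hsR⟩ y
  have hs : 0 < s := hr.trans_le hrs
  have h0 := heatKernel_nonneg hs.le y
  have h1 := heatKernel_le hr hrs hsR y
  have h2 := mul_exp_neg_mul_le (c := 1 / (4 * R)) (by positivity) (‖y‖ ^ 2)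
  have e : -(1 / (4 * R) / 2) * ‖y‖ ^ 2 = -(1 / (8 * R)) * ‖y‖ ^ 2 := by ring
  rw [e] at h2
  have h3 : Real.exp (-(1 / (4 * R)) * ‖y‖ ^ 2) ≤ Real.exp (-(1 / (8 * R)) * ‖y‖ ^ 2) := by
    gcongr
    norm_num
  have h4 : |‖y‖ ^ 2 / (4 * s ^ 2) - d / (2 * s)| ≤ 1 / (4 * r ^ 2) * ‖y‖ ^ 2 + d / (2 * r) := by
    have h5 : ‖y‖ ^ 2 / (4 * s ^ 2) ≤ 1 / (4 * r ^ 2) * ‖y‖ ^ 2 := by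
      rw [one_div_mul_eq_div]; gcongr
    have h6 : (d : ℝ) / (2 * s) ≤ d / (2 * r) := by gcongr
    have h7 : 0 ≤ ‖y‖ ^ 2 / (4 * s ^ 2) := by positivity
    have h8 : 0 ≤ (d : ℝ) / (2 * s) := by positivity
    rw [abs_le]; constructor <;> linarith
  rw [abs_mul, abs_of_nonneg h0]
  calc _ ≤ (1 / (4 * r ^ 2) * ‖y‖ ^ 2 + d / (2 * r)) *
        (A * Real.exp (-(1 / (4 * R)) * ‖y‖ ^ 2)) := by gcongr
    _ = A * (1 / (4 * r ^ 2) * (‖y‖ ^ 2 * Real.exp (-(1 / (4 * R)) * ‖y‖ ^ 2)) +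
        d / (2 * r) * Real.exp (-(1 / (4 * R)) * ‖y‖ ^ 2)) := by ring
    _ ≤ A * (1 / (4 * r ^ 2) * (2 / (1 / (4 * R)) * Real.exp (-(1 / (8 * R)) * ‖y‖ ^ 2)) +
        d / (2 * r) * Real.exp (-(1 / (8 * R)) * ‖y‖ ^ 2)) := by gcongr
    _ = _ := by ring

lemma integrable_and_integral_norm_sq_mul_heatKernel {d : ℕ} {t : ℝ} (ht : 0 < t) :
    Integrable (fun y => ‖y‖ ^ 2 * heatKernel d t y) ∧
      ∫ y, ‖y‖ ^ 2 * heatKernel d t y = 2 * d * t := by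
  obtain ⟨C, -, hC⟩ := exists_abs_deriv_heatKernel_le d (r := t / 2) (R := 2 * t)
    (by positivity) (by linarith)
  obtain ⟨hi, hd⟩ := hasDerivAt_integral_of_dominated_loc_of_deriv_le
    (F := fun s y => heatKernel d s y) (x₀ := t) (s := Icc (t / 2) (2 * t))
    (F' := fun s y => (‖y‖ ^ 2 / (4 * s ^ 2) - d / (2 * s)) * heatKernel d s y)
    (μ := volume) (Icc_mem_nhds (by linarith) (by linarith))
    (.of_forall fun s => (continuous_heatKernel s).aestronglyMeasurable)
    (integrable_heatKernel ht)
    (by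
      have := continuous_heatKernel (d := d) t
      exact Continuous.aestronglyMeasurable (by fun_prop))
    (.of_forall fun y s hs => hC s hs y)
    ((integrable_exp_neg_mul_norm_sq (by positivity)).const_mul C)
    (.of_forall fun y s hs => hasDerivAt_heatKernel (by linarith [hs.1]) y)
  have h1 : HasDerivAt (fun s => ∫ y, heatKernel d s y) 0 t := by
    refine (hasDerivAt_const t (1 : ℝ)).congr_of_eventuallyEq ?_
    filter_upwards [lt_mem_nhds ht] with s hs using integral_heatKernel hs
  have h2 := hd.unique h1
  have hk := integrable_heatKernel (d := d) ht
  have e : ∀ y : EuclideanSpace ℝ (Fin d), ‖y‖ ^ 2 * heatKernel d t y =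
      4 * t ^ 2 * ((‖y‖ ^ 2 / (4 * t ^ 2) - d / (2 * t)) * heatKernel d t y) +
        2 * d * t * heatKernel d t y := by
    intro y; field_simp; ring
  simp_rw [e]
  refine ⟨(hi.const_mul _).add (hk.const_mul _), ?_⟩
  rw [integral_add (hi.const_mul _) (hk.const_mul _), integral_const_mul, integral_const_mul,
    h2, integral_heatKernel ht]
  ring

lemma integral_inner_mul_heatKernel {d : ℕ} (t : ℝ) (c : EuclideanSpace ℝ (Fin d)) :
    ∫ y, inner ℝ y c * heatKernel d t y = 0 := by
  have h := integral_neg_eq_self (fun y => inner ℝ y c * heatKernel d t y) volume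
  simp only [inner_neg_left, heatKernel_neg, neg_mul, integral_neg] at h
  linarith

lemma integrable_and_integral_norm_sq_mul_heatKernel_sub {d : ℕ} {t : ℝ} (ht : 0 < t)
    (c : EuclideanSpace ℝ (Fin d)) :
    Integrable (fun w => ‖w‖ ^ 2 * heatKernel d t (w - c)) ∧
      ∫ w, ‖w‖ ^ 2 * heatKernel d t (w - c) = 2 * d * t + ‖c‖ ^ 2 := by
  obtain ⟨hi, hv⟩ := integrable_and_integral_norm_sq_mul_heatKernel (d := d) ht
  have hk := integrable_heatKernel (d := d) ht
  have hc := continuous_heatKernel (d := d) t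
  have hj : Integrable (fun y => inner ℝ y c * heatKernel d t y) := by
    refine ((hi.add (hk.const_mul (‖c‖ ^ 2)))).mono'
      (Continuous.aestronglyMeasurable (by fun_prop)) (.of_forall fun y => ?_)
    have h0 := heatKernel_nonneg ht.le y
    rw [Real.norm_eq_abs, abs_mul, abs_of_nonneg h0]
    simp only [Pi.add_apply, ← add_mul]
    gcongr
    have := abs_real_inner_le_norm y c
    nlinarith [sq_nonneg (‖y‖ - ‖c‖)]
  have e : ∀ y : EuclideanSpace ℝ (Fin d), ‖y + c‖ ^ 2 * heatKernel d t y =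
      ‖y‖ ^ 2 * heatKernel d t y + 2 * (inner ℝ y c * heatKernel d t y) +
        ‖c‖ ^ 2 * heatKernel d t y := by
    intro y; rw [norm_add_sq_real]; ring
  have hs : Integrable (fun y => ‖y + c‖ ^ 2 * heatKernel d t y) := by
    simp_rw [e]
    exact (hi.add (hj.const_mul 2)).add (hk.const_mul _)
  refine ⟨by simpa using hs.comp_sub_right c, ?_⟩
  rw [← integral_add_right_eq_self _ c]
  simp only [add_sub_cancel_right]
  simp_rw [e]
  rw [integral_add (by exact hi.add (hj.const_mul 2)) (hk.const_mul _),
    integral_add hi (hj.const_mul _),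
    integral_const_mul, integral_const_mul, hv, integral_inner_mul_heatKernel,
    integral_heatKernel ht]
  ring

/-- Measurable functions that are square integrable against every centred Gaussian. -/
structure GaussianSqIntegrable {d : ℕ} (a : EuclideanSpace ℝ (Fin d) → ℝ) : Prop where
  measurable : Measurable a
  integrable : ∀ c : ℝ, 0 < c → Integrable (fun y => Real.exp (-c * ‖y‖ ^ 2) * a y ^ 2)

namespace GaussianSqIntegrable

variable {d : ℕ} {a b : EuclideanSpace ℝ (Fin d) → ℝ}

lemma of_sq_le (ha : GaussianSqIntegrable a) (hb : GaussianSqIntegrable b)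
    {f : EuclideanSpace ℝ (Fin d) → ℝ} (hf : Measurable f)
    (h : ∀ y, f y ^ 2 ≤ 2 * a y ^ 2 + 2 * b y ^ 2) : GaussianSqIntegrable f := by
  refine ⟨hf, fun c hc => ?_⟩
  refine (((ha.integrable c hc).const_mul 2).add ((hb.integrable c hc).const_mul 2)).mono'
    (by fun_prop) (.of_forall fun y => ?_)
  rw [Real.norm_of_nonneg (by positivity)]
  have := mul_le_mul_of_nonneg_left (h y) (Real.exp_pos (-c * ‖y‖ ^ 2)).le
  simp only [Pi.add_apply]
  linarith

lemma add (ha : GaussianSqIntegrable a) (hb : GaussianSqIntegrable b) :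
    GaussianSqIntegrable (fun y => a y + b y) :=
  ha.of_sq_le hb (ha.measurable.add hb.measurable)
    fun y => by nlinarith [sq_nonneg (a y - b y)]

lemma sub (ha : GaussianSqIntegrable a) (hb : GaussianSqIntegrable b) :
    GaussianSqIntegrable (fun y => a y - b y) :=
  ha.of_sq_le hb (ha.measurable.sub hb.measurable)
    fun y => by nlinarith [sq_nonneg (a y + b y)]

lemma integrable_exp_mul_abs (ha : GaussianSqIntegrable a) {c : ℝ} (hc : 0 < c) :
    Integrable (fun y => Real.exp (-c * ‖y‖ ^ 2) * |a y|) := by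
  have := ha.measurable
  refine ((integrable_exp_neg_mul_norm_sq hc).add (ha.integrable c hc)).mono'
    (by fun_prop) (.of_forall fun y => ?_)
  rw [Real.norm_of_nonneg (by positivity), Pi.add_apply]
  have h1 : |a y| ≤ 1 + a y ^ 2 := by nlinarith [sq_abs (a y), sq_nonneg (|a y| - 1)]
  have := mul_le_mul_of_nonneg_left h1 (Real.exp_pos (-c * ‖y‖ ^ 2)).le
  linarith

lemma of_continuous_of_bounded (ha : Continuous a) {B : ℝ} (hB : ∀ y, |a y| ≤ B) :
    GaussianSqIntegrable a := by
  have := ha.measurable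
  refine ⟨this, fun c hc => ?_⟩
  refine ((integrable_exp_neg_mul_norm_sq hc).mul_const (B ^ 2)).mono'
    (by fun_prop) (.of_forall fun y => ?_)
  rw [Real.norm_of_nonneg (by positivity)]
  rw [← sq_abs (a y)]
  gcongr
  exact hB y

/-- A function with at most a `|x|⁻¹` singularity is Gaussian square integrable in dimension
at least three. -/
lemma of_abs_le_inv_norm (hd : 3 ≤ d) (ha : Measurable a) {M : ℝ}
    (h : ∀ x, x ≠ 0 → |a x| ≤ M * ‖x‖⁻¹) : GaussianSqIntegrable a := by
  have : NeZero d := ⟨by omega⟩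
  refine ⟨ha, fun c hc => ?_⟩
  have h1 : Integrable (fun x : EuclideanSpace ℝ (Fin d) =>
      (fun r : ℝ => Real.exp (-c * r ^ 2) * (M * r⁻¹) ^ 2) ‖x‖) := by
    refine (integrable_fun_norm_addHaar volume
      (f := fun r : ℝ => Real.exp (-c * r ^ 2) * (M * r⁻¹) ^ 2)).2 ?_
    have h2 := (integrableOn_rpow_mul_exp_neg_mul_rpow (p := 2) (s := (d : ℝ) - 3) (b := c)
      (by have : (3 : ℝ) ≤ d := by exact_mod_cast hd
          linarith) (by norm_num) hc).const_mul (M ^ 2)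
    refine IntegrableOn.congr_fun h2 (fun r hr => ?_) measurableSet_Ioi
    have hr : 0 < r := hr
    obtain ⟨k, rfl⟩ := Nat.exists_eq_add_of_le hd
    have e1 : (((3 + k : ℕ) : ℝ) - 3) = (k : ℝ) := by push_cast; ring
    have e2 : 3 + k - 1 = k + 2 := by omega
    simp only [finrank_euclideanSpace, Fintype.card_fin, smul_eq_mul, e1, e2, Real.rpow_natCast,
      Real.rpow_ofNat]
    field_simp
    ring
  refine h1.mono' (by fun_prop) ?_
  have h0 : ∀ᵐ x : EuclideanSpace ℝ (Fin d), x ≠ 0 := by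
    have : Nontrivial (EuclideanSpace ℝ (Fin d)) := inferInstance
    exact Measure.ae_ne volume 0
  filter_upwards [h0] with x hx
  rw [Real.norm_of_nonneg (by positivity)]
  rw [← sq_abs (a x)]
  gcongr
  exact h x hx

end GaussianSqIntegrable

/-- `∫ g_{t-s}(x-w) g_s(w-y) g_s(w-z) dw` in closed form, where `p = (y, z)`. -/
noncomputable def twoPointKernel (d : ℕ) (t : ℝ) (x : EuclideanSpace ℝ (Fin d)) (s : ℝ)
    (p : EuclideanSpace ℝ (Fin d) × EuclideanSpace ℝ (Fin d)) : ℝ :=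
  heatKernel d (t - s / 2) (x - (1 / 2 : ℝ) • (p.1 + p.2)) * heatKernel d (2 * s) (p.1 - p.2)

/-- The derivative of `twoPointKernel` with respect to `s`. -/
noncomputable def twoPointKernelDeriv (d : ℕ) (t : ℝ) (x : EuclideanSpace ℝ (Fin d)) (s : ℝ)
    (p : EuclideanSpace ℝ (Fin d) × EuclideanSpace ℝ (Fin d)) : ℝ :=
  -(1 / 2) * ((‖x - (1 / 2 : ℝ) • (p.1 + p.2)‖ ^ 2 / (4 * (t - s / 2) ^ 2) -
      d / (2 * (t - s / 2))) * heatKernel d (t - s / 2) (x - (1 / 2 : ℝ) • (p.1 + p.2))) *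
      heatKernel d (2 * s) (p.1 - p.2) +
    2 * heatKernel d (t - s / 2) (x - (1 / 2 : ℝ) • (p.1 + p.2)) *
      ((‖p.1 - p.2‖ ^ 2 / (4 * (2 * s) ^ 2) - d / (2 * (2 * s))) *
        heatKernel d (2 * s) (p.1 - p.2))

section TwoPoint

variable {d : ℕ} {t s : ℝ} {x : EuclideanSpace ℝ (Fin d)}

lemma twoPointKernel_nonneg (hs : 0 ≤ s) (hst : s ≤ 2 * t)
    (p : EuclideanSpace ℝ (Fin d) × EuclideanSpace ℝ (Fin d)) :
    0 ≤ twoPointKernel d t x s p :=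
  mul_nonneg (heatKernel_nonneg (by linarith) _) (heatKernel_nonneg (by linarith) _)

lemma twoPointKernel_swap (y z : EuclideanSpace ℝ (Fin d)) :
    twoPointKernel d t x s (y, z) = twoPointKernel d t x s (z, y) := by
  simp only [twoPointKernel]
  rw [heatKernel_sub_comm _ y z, add_comm y z]

lemma continuous_twoPointKernel : Continuous (twoPointKernel d t x s) := by
  have h1 := continuous_heatKernel (d := d) (t - s / 2)
  have h2 := continuous_heatKernel (d := d) (2 * s)
  unfold twoPointKernel; fun_prop

lemma continuous_twoPointKernelDeriv : Continuous (twoPointKernelDeriv d t x s) := by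
  have h1 := continuous_heatKernel (d := d) (t - s / 2)
  have h2 := continuous_heatKernel (d := d) (2 * s)
  unfold twoPointKernelDeriv; fun_prop

lemma hasDerivAt_twoPointKernel (hs : 0 < s) (hst : s < 2 * t)
    (p : EuclideanSpace ℝ (Fin d) × EuclideanSpace ℝ (Fin d)) :
    HasDerivAt (fun r => twoPointKernel d t x r p) (twoPointKernelDeriv d t x s p) s := by
  have e1 : HasDerivAt (fun r : ℝ => t - r / 2) (-(1 / 2)) s := by
    simpa using ((hasDerivAt_id s).div_const 2).const_sub t
  have e2 : HasDerivAt (fun r : ℝ => 2 * r) 2 s := by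
    simpa using (hasDerivAt_id s).const_mul (2 : ℝ)
  have h1 := (hasDerivAt_heatKernel (t := t - s / 2) (by linarith)
    (x - (1 / 2 : ℝ) • (p.1 + p.2))).comp s e1
  have h2 := (hasDerivAt_heatKernel (t := 2 * s) (by linarith) (p.1 - p.2)).comp s e2
  refine (h1.mul h2).congr_deriv ?_
  simp only [twoPointKernelDeriv, Function.comp_apply]
  ring

lemma exp_mul_exp_two_point_le {c : ℝ} (hc : 0 ≤ c) (x y z : EuclideanSpace ℝ (Fin d)) :
    Real.exp (-c * ‖x - (1 / 2 : ℝ) • (y + z)‖ ^ 2) * Real.exp (-c * ‖y - z‖ ^ 2) ≤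
      Real.exp (c * ‖x‖ ^ 2) *
        (Real.exp (-(c / 4) * ‖y‖ ^ 2) * Real.exp (-(c / 4) * ‖z‖ ^ 2)) := by
  rw [← Real.exp_add, ← Real.exp_add, ← Real.exp_add, Real.exp_le_exp]
  set m := (1 / 2 : ℝ) • (y + z) with hm
  have h1 : ‖y‖ ^ 2 + ‖z‖ ^ 2 = 2 * ‖m‖ ^ 2 + ‖y - z‖ ^ 2 / 2 := by
    rw [hm, norm_smul, mul_pow, norm_sub_sq_real, norm_add_sq_real]
    norm_num
    ring
  have h2 : ‖m‖ ≤ ‖x‖ + ‖x - m‖ := by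
    calc ‖m‖ = ‖x - (x - m)‖ := by congr 1; abel
      _ ≤ _ := norm_sub_le _ _
  have h3 : ‖m‖ ^ 2 ≤ 2 * ‖x‖ ^ 2 + 2 * ‖x - m‖ ^ 2 := by
    nlinarith [norm_nonneg m, norm_nonneg x, norm_nonneg (x - m), sq_nonneg (‖x‖ - ‖x - m‖)]
  have h4 : (‖y‖ ^ 2 + ‖z‖ ^ 2) / 4 ≤ ‖x‖ ^ 2 + ‖x - m‖ ^ 2 + ‖y - z‖ ^ 2 := by
    nlinarith [sq_nonneg ‖y - z‖]
  nlinarith [mul_le_mul_of_nonneg_left h4 hc]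

/-- Locally uniformly in `s`, the two-point kernel and its derivative are dominated by a product
of Gaussians. -/
lemma exists_twoPointKernel_le {r R : ℝ} (ht : 0 < t) (x : EuclideanSpace ℝ (Fin d))
    (hr : 0 < r) (hR : R < 2 * t) :
    ∃ C c : ℝ, 0 < c ∧ ∀ s ∈ Icc r R, ∀ y z,
      |twoPointKernel d t x s (y, z)| ≤
        C * (Real.exp (-c * ‖y‖ ^ 2) * Real.exp (-c * ‖z‖ ^ 2)) ∧
      |twoPointKernelDeriv d t x s (y, z)| ≤
        C * (Real.exp (-c * ‖y‖ ^ 2) * Real.exp (-c * ‖z‖ ^ 2)) := by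
  rcases lt_or_ge R r with hlt | hrR
  · exact ⟨0, 1, one_pos, fun s hs => absurd (hs.1.trans hs.2) (not_le.2 hlt)⟩
  set ρ := min (t - R / 2) (2 * r) with hρ
  have hρ0 : 0 < ρ := lt_min (by linarith) (by linarith)
  have hρ1 : ρ ≤ 4 * t := (min_le_left _ _).trans (by linarith)
  obtain ⟨C, hC0, hC⟩ := exists_abs_deriv_heatKernel_le d hρ0 hρ1
  set c : ℝ := 1 / (8 * (4 * t)) with hc
  have hc0 : 0 < c := by positivity
  set A : ℝ := (4 * Real.pi * ρ) ^ (-(d : ℝ) / 2) with hA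
  have hA0 : 0 ≤ A := by positivity
  have hK : ∀ s ∈ Icc ρ (4 * t), ∀ y : EuclideanSpace ℝ (Fin d),
      |heatKernel d s y| ≤ (A + C) * Real.exp (-c * ‖y‖ ^ 2) := by
    intro s hs y
    rw [abs_of_nonneg (heatKernel_nonneg (hρ0.le.trans hs.1) y)]
    refine (heatKernel_le hρ0 hs.1 hs.2 y).trans ?_
    have : c ≤ 1 / (4 * (4 * t)) := by rw [hc]; gcongr; norm_num
    gcongr
    linarith
  have hD : ∀ s ∈ Icc ρ (4 * t), ∀ y : EuclideanSpace ℝ (Fin d),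
      |(‖y‖ ^ 2 / (4 * s ^ 2) - d / (2 * s)) * heatKernel d s y| ≤
        (A + C) * Real.exp (-c * ‖y‖ ^ 2) := by
    intro s hs y
    refine (hC s hs y).trans ?_
    gcongr
    linarith
  have hB0 : 0 ≤ A + C := by positivity
  set B := A + C
  refine ⟨3 * (B ^ 2 * Real.exp (c * ‖x‖ ^ 2)), c / 4, by positivity, fun s hs y z => ?_⟩
  have m1 : t - s / 2 ∈ Icc ρ (4 * t) :=
    ⟨(min_le_left _ _).trans (by linarith [hs.2]), by linarith [hs.1]⟩
  have m2 : 2 * s ∈ Icc ρ (4 * t) :=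
    ⟨(min_le_right _ _).trans (by linarith [hs.1]), by linarith [hs.2]⟩
  have key := mul_le_mul_of_nonneg_left (exp_mul_exp_two_point_le hc0.le x y z) (sq_nonneg B)
  have k1 := hK _ m1 (x - (1 / 2 : ℝ) • (y + z))
  have k2 := hK _ m2 (y - z)
  have l1 := hD _ m1 (x - (1 / 2 : ℝ) • (y + z))
  have l2 := hD _ m2 (y - z)
  have q0 : 0 ≤ B ^ 2 * (Real.exp (-c * ‖x - (1 / 2 : ℝ) • (y + z)‖ ^ 2) *
    Real.exp (-c * ‖y - z‖ ^ 2)) := by positivity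
  have q1 := mul_le_mul k1 k2 (abs_nonneg _) (by positivity)
  have q2 := mul_le_mul l1 k2 (abs_nonneg _) (by positivity)
  have q3 := mul_le_mul k1 l2 (abs_nonneg _) (by positivity)
  rw [← abs_mul] at q1 q2 q3
  constructor
  · simp only [twoPointKernel]
    nlinarith
  · simp only [twoPointKernelDeriv]
    rw [mul_assoc, mul_assoc 2]
    refine (abs_add_le _ _).trans ?_
    rw [abs_mul (-(1 / 2) : ℝ), abs_mul (2 : ℝ)]
    norm_num only [abs_neg, abs_of_pos]
    nlinarith

end TwoPoint

section TwoPointIntegral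

variable {d : ℕ} {t s : ℝ} {a b : EuclideanSpace ℝ (Fin d) → ℝ}

lemma integrable_of_abs_le_exp_mul_exp
    {k : EuclideanSpace ℝ (Fin d) × EuclideanSpace ℝ (Fin d) → ℝ} (hk : Continuous k)
    {f g : EuclideanSpace ℝ (Fin d) → ℝ} (hf : Measurable f) (hg : Measurable g) {C c : ℝ}
    (hfi : Integrable (fun y => Real.exp (-c * ‖y‖ ^ 2) * |f y|))
    (hgi : Integrable (fun y => Real.exp (-c * ‖y‖ ^ 2) * |g y|))
    (h : ∀ y z, |k (y, z)| ≤ C * (Real.exp (-c * ‖y‖ ^ 2) * Real.exp (-c * ‖z‖ ^ 2))) :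
    Integrable (fun p => k p * (f p.1 * g p.2)) := by
  have hk' := hk.measurable
  refine ((hfi.mul_prod hgi).const_mul C).mono' (by fun_prop) (.of_forall fun p => ?_)
  rw [Real.norm_eq_abs, abs_mul, abs_mul]
  have := mul_le_mul_of_nonneg_right (h p.1 p.2)
    (mul_nonneg (abs_nonneg (f p.1)) (abs_nonneg (g p.2)))
  refine this.trans (le_of_eq ?_)
  ring

/-- The bilinear form `∫∫ K_s(y, z) a(y) b(z)` is differentiable in `s ∈ (0, 2t)`. -/
lemma hasDerivAt_integral_twoPointKernel (ha : GaussianSqIntegrable a)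
    (hb : GaussianSqIntegrable b) (x : EuclideanSpace ℝ (Fin d)) (hs : 0 < s) (hst : s < 2 * t) :
    Integrable (fun p => twoPointKernelDeriv d t x s p * (a p.1 * b p.2)) ∧
    HasDerivAt (fun r => ∫ p, twoPointKernel d t x r p * (a p.1 * b p.2))
      (∫ p, twoPointKernelDeriv d t x s p * (a p.1 * b p.2)) s := by
  have hma := ha.measurable
  have hmb := hb.measurable
  obtain ⟨R, hsR, hRt⟩ := exists_between hst
  obtain ⟨C, c, hc, hC⟩ := exists_twoPointKernel_le (r := s / 2) (by linarith : 0 < t) x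
    (by positivity) hRt
  have hfi := ha.integrable_exp_mul_abs hc
  have hgi := hb.integrable_exp_mul_abs hc
  have hms : s ∈ Icc (s / 2) R := ⟨by linarith, hsR.le⟩
  refine hasDerivAt_integral_of_dominated_loc_of_deriv_le
    (F := fun r p => twoPointKernel d t x r p * (a p.1 * b p.2))
    (F' := fun r p => twoPointKernelDeriv d t x r p * (a p.1 * b p.2))
    (bound := fun p => C * ((Real.exp (-c * ‖p.1‖ ^ 2) * |a p.1|) *
      (Real.exp (-c * ‖p.2‖ ^ 2) * |b p.2|)))
    (s := Icc (s / 2) R) (Icc_mem_nhds (by linarith) hsR)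
    (.of_forall fun r => ?_) ?_ ?_ (.of_forall fun p r hr => ?_)
    ((hfi.mul_prod hgi).const_mul C) (.of_forall fun p r hr => ?_)
  · have := (continuous_twoPointKernel (d := d) (t := t) (s := r) (x := x)).measurable
    fun_prop
  · exact integrable_of_abs_le_exp_mul_exp continuous_twoPointKernel hma hmb hfi hgi
      fun y z => (hC s hms y z).1
  · have := (continuous_twoPointKernelDeriv (d := d) (t := t) (s := s) (x := x)).measurable
    fun_prop
  · rw [Real.norm_eq_abs, abs_mul, abs_mul]
    have := mul_le_mul_of_nonneg_right (hC r hr p.1 p.2).2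
      (mul_nonneg (abs_nonneg (a p.1)) (abs_nonneg (b p.2)))
    refine this.trans (le_of_eq ?_)
    ring
  · exact (hasDerivAt_twoPointKernel (by linarith [hr.1]) (by linarith [hr.2]) p).mul_const _

lemma heatKernel_sub_mul_heatKernel_sub (hs : 0 < s) (w y z : EuclideanSpace ℝ (Fin d)) :
    heatKernel d s (w - y) * heatKernel d s (w - z) =
      heatKernel d (2 * s) (y - z) * heatKernel d (s / 2) (w - (1 / 2 : ℝ) • (y + z)) := by
  have h := heatKernel_mul_heatKernel hs hs (y - z) (w - z)
  have e1 : y - z - (w - z) = y - w := by abel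
  have e2 : s * s / (s + s) = s / 2 := by field_simp; ring
  have e3 : s / (s + s) = 1 / 2 := by field_simp; ring
  have e4 : w - z - (1 / 2 : ℝ) • (y - z) = w - (1 / 2 : ℝ) • (y + z) := by module
  rw [e1, e2, e3, e4, heatKernel_sub_comm, ← two_mul] at h
  exact h

/-- At `s = t` the bilinear form factorises. -/
lemma integral_twoPointKernel_self (ht : 0 < t) (x : EuclideanSpace ℝ (Fin d)) :
    ∫ p, twoPointKernel d t x t p * (a p.1 * b p.2) = heat d t a x * heat d t b x := by
  unfold heat
  rw [← integral_prod_mul]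
  congr 1 with p
  have h := heatKernel_sub_mul_heatKernel_sub ht x p.1 p.2
  have e : t - t / 2 = t / 2 := by ring
  rw [twoPointKernel, e, mul_comm (heatKernel d (t / 2) _), ← h]
  ring

lemma inner_sub_sub_eq (w y z : EuclideanSpace ℝ (Fin d)) :
    inner ℝ (w - y) (w - z) = ‖w - (1 / 2 : ℝ) • (y + z)‖ ^ 2 - ‖y - z‖ ^ 2 / 4 := by
  have e1 : w - y = (w - (1 / 2 : ℝ) • (y + z)) - (1 / 2 : ℝ) • (y - z) := by module
  have e2 : w - z = (w - (1 / 2 : ℝ) • (y + z)) + (1 / 2 : ℝ) • (y - z) := by module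
  rw [e1, e2]
  generalize w - (1 / 2 : ℝ) • (y + z) = p
  generalize y - z = q
  simp only [inner_sub_left, inner_add_right, inner_smul_left, inner_smul_right,
    real_inner_self_eq_norm_sq, real_inner_comm p q]
  simp
  ring

/-- The derivative of the two-point kernel is `-2 ∫ g_{t-s}(x-w) ∇g_s(w-y)·∇g_s(w-z) dw`. -/
lemma integral_heatKernel_mul_grad_mul_grad (hs : 0 < s) (hst : s < t)
    (x y z : EuclideanSpace ℝ (Fin d)) :
    ∫ w, heatKernel d (t - s) (x - w) * (inner ℝ (w - y) (w - z) / (4 * s ^ 2) *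
      (heatKernel d s (w - y) * heatKernel d s (w - z))) =
      -(1 / 2) * twoPointKernelDeriv d t x s (y, z) := by
  set m := (1 / 2 : ℝ) • (y + z) with hm
  have hτ : 0 < t - s := by linarith
  have hσ : 0 < s / 2 := by linarith
  have hts : t - s + s / 2 = t - s / 2 := by ring
  have hts0 : 0 < t - s / 2 := by linarith
  set ρ := (t - s) * (s / 2) / (t - s / 2) with hρ
  set c := (s / 2 / (t - s / 2)) • (x - m) with hc
  have hρ0 : 0 < ρ := by positivity
  obtain ⟨hi, hv⟩ := integrable_and_integral_norm_sq_mul_heatKernel_sub hρ0 c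
  have hk : Integrable (fun w => heatKernel d ρ (w - c)) :=
    (integrable_heatKernel hρ0).comp_sub_right c
  have hk1 : ∫ w, heatKernel d ρ (w - c) = 1 := by
    rw [integral_sub_right_eq_self (heatKernel d ρ), integral_heatKernel hρ0]
  rw [← integral_add_right_eq_self _ m]
  have e : ∀ w : EuclideanSpace ℝ (Fin d), heatKernel d (t - s) (x - (w + m)) *
      (inner ℝ (w + m - y) (w + m - z) / (4 * s ^ 2) *
        (heatKernel d s (w + m - y) * heatKernel d s (w + m - z))) =
      heatKernel d (t - s / 2) (x - m) * heatKernel d (2 * s) (y - z) / (4 * s ^ 2) *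
        (‖w‖ ^ 2 * heatKernel d ρ (w - c) - ‖y - z‖ ^ 2 / 4 * heatKernel d ρ (w - c)) := by
    intro w
    have h1 := heatKernel_mul_heatKernel hτ hσ (x - m) w
    rw [hts, ← hρ, ← hc] at h1
    have e1 : x - (w + m) = x - m - w := by abel
    rw [heatKernel_sub_mul_heatKernel_sub hs, inner_sub_sub_eq, ← hm, add_sub_cancel_right, e1]
    linear_combination (‖w‖ ^ 2 - ‖y - z‖ ^ 2 / 4) / (4 * s ^ 2) * heatKernel d (2 * s) (y - z) * h1
  simp_rw [e]
  rw [integral_const_mul, integral_sub hi (hk.const_mul _), integral_const_mul, hv, hk1,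
    twoPointKernelDeriv]
  simp only [← hm]
  have hcn : ‖c‖ ^ 2 = (s / 2 / (t - s / 2)) ^ 2 * ‖x - m‖ ^ 2 := by
    rw [hc, norm_smul, mul_pow, Real.norm_eq_abs, sq_abs]
  rw [hcn, hρ]
  have h2 : t * 2 - s ≠ 0 := by linarith
  field_simp
  ring

end TwoPointIntegral

section Gradient

variable {d : ℕ} {t s : ℝ} {a b : EuclideanSpace ℝ (Fin d) → ℝ}

lemma hasFDerivAt_heatKernel (s : ℝ) (v : EuclideanSpace ℝ (Fin d)) :
    HasFDerivAt (heatKernel d s) ((-(1 / (2 * s)) * heatKernel d s v) • innerSL ℝ v) v := by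
  unfold heatKernel
  have h1 : HasFDerivAt (fun y : EuclideanSpace ℝ (Fin d) => ‖y‖ ^ 2) (2 • innerSL ℝ v) v :=
    (hasStrictFDerivAt_norm_sq v).hasFDerivAt
  have h2 := ((h1.const_mul (-(1 / (4 * s)))).exp).const_mul ((4 * Real.pi * s) ^ (-(d : ℝ) / 2))
  have e : ∀ y : EuclideanSpace ℝ (Fin d), -‖y‖ ^ 2 / (4 * s) = -(1 / (4 * s)) * ‖y‖ ^ 2 := by
    intro y; ring
  simp_rw [e]
  refine h2.congr_fderiv ?_
  ext u
  simp
  ring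

/-- The gradient of the heat kernel is dominated by a Gaussian. -/
lemma exists_norm_mul_heatKernel_le (d : ℕ) (hs : 0 < s) :
    ∃ C : ℝ, 0 ≤ C ∧ ∀ v : EuclideanSpace ℝ (Fin d),
      heatKernel d s v ≤ C * Real.exp (-(1 / (8 * s)) * ‖v‖ ^ 2) ∧
      ‖v‖ * heatKernel d s v ≤ C * Real.exp (-(1 / (8 * s)) * ‖v‖ ^ 2) := by
  set A : ℝ := (4 * Real.pi * s) ^ (-(d : ℝ) / 2) with hA
  have hA0 : 0 ≤ A := by positivity
  refine ⟨A * (1 + 2 / (1 / (4 * s))), by positivity, fun v => ?_⟩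
  have h1 := mul_exp_neg_mul_le (c := 1 / (4 * s)) (by positivity) (‖v‖ ^ 2)
  have e : -(1 / (4 * s) / 2) * ‖v‖ ^ 2 = -(1 / (8 * s)) * ‖v‖ ^ 2 := by ring
  rw [e] at h1
  have h2 : Real.exp (-(1 / (4 * s)) * ‖v‖ ^ 2) ≤ Real.exp (-(1 / (8 * s)) * ‖v‖ ^ 2) := by
    gcongr
    norm_num
  have h3 : ‖v‖ ≤ 1 + ‖v‖ ^ 2 := by nlinarith [sq_nonneg (‖v‖ - 1)]
  rw [heatKernel_eq, ← hA]
  constructor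
  · rw [mul_assoc]
    gcongr
    have : 0 ≤ 2 / (1 / (4 * s)) * Real.exp (-(1 / (8 * s)) * ‖v‖ ^ 2) := by positivity
    linarith
  · calc _ ≤ (1 + ‖v‖ ^ 2) * (A * Real.exp (-(1 / (4 * s)) * ‖v‖ ^ 2)) := by gcongr
      _ = A * (Real.exp (-(1 / (4 * s)) * ‖v‖ ^ 2) +
          ‖v‖ ^ 2 * Real.exp (-(1 / (4 * s)) * ‖v‖ ^ 2)) := by ring
      _ ≤ A * (Real.exp (-(1 / (8 * s)) * ‖v‖ ^ 2) +
          2 / (1 / (4 * s)) * Real.exp (-(1 / (8 * s)) * ‖v‖ ^ 2)) := by gcongr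
      _ = _ := by ring

lemma exp_neg_mul_norm_sub_sq_le {c : ℝ} (hc : 0 ≤ c) (w y : EuclideanSpace ℝ (Fin d)) :
    Real.exp (-c * ‖w - y‖ ^ 2) ≤
      Real.exp (c * ‖w‖ ^ 2) * Real.exp (-(c / 2) * ‖y‖ ^ 2) := by
  rw [← Real.exp_add, Real.exp_le_exp]
  have h2 : ‖y‖ ≤ ‖w‖ + ‖w - y‖ := by
    calc ‖y‖ = ‖w - (w - y)‖ := by congr 1; abel
      _ ≤ _ := norm_sub_le _ _
  have h3 : ‖y‖ ^ 2 ≤ 2 * ‖w‖ ^ 2 + 2 * ‖w - y‖ ^ 2 := by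
    nlinarith [norm_nonneg y, norm_nonneg w, norm_nonneg (w - y), sq_nonneg (‖w‖ - ‖w - y‖)]
  nlinarith [mul_le_mul_of_nonneg_left h3 hc]

lemma hasFDerivAt_heat (ha : GaussianSqIntegrable a) (hs : 0 < s)
    (w : EuclideanSpace ℝ (Fin d)) :
    Integrable (fun y => a y • (-(1 / (2 * s)) * heatKernel d s (w - y)) • innerSL ℝ (w - y)) ∧
    HasFDerivAt (heat d s a)
      (∫ y, a y • (-(1 / (2 * s)) * heatKernel d s (w - y)) • innerSL ℝ (w - y)) w := by
  have hma := ha.measurable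
  obtain ⟨C, hC0, hC⟩ := exists_norm_mul_heatKernel_le d hs
  set c : ℝ := 1 / (8 * s) with hc
  have hc0 : 0 < c := by positivity
  set A : ℝ := 1 / (2 * s) * (C * Real.exp (c * (‖w‖ + 1) ^ 2)) with hA
  have hbound : Integrable (fun y => A * (Real.exp (-(c / 2) * ‖y‖ ^ 2) * |a y|)) :=
    (ha.integrable_exp_mul_abs (by positivity)).const_mul A
  have hgauss : ∀ v ∈ Metric.ball w 1, ∀ y, Real.exp (-c * ‖v - y‖ ^ 2) ≤
      Real.exp (c * (‖w‖ + 1) ^ 2) * Real.exp (-(c / 2) * ‖y‖ ^ 2) := by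
    intro v hv y
    refine (exp_neg_mul_norm_sub_sq_le hc0.le v y).trans ?_
    have : ‖v‖ ≤ ‖w‖ + 1 := by
      have h1 := norm_sub_norm_le v w
      rw [Metric.mem_ball, dist_eq_norm] at hv
      linarith
    gcongr
  have hmeas : AEStronglyMeasurable
      (fun y => a y • (-(1 / (2 * s)) * heatKernel d s (w - y)) • innerSL ℝ (w - y)) := by
    have h1 := continuous_heatKernel (d := d) s
    refine hma.aestronglyMeasurable.smul (Continuous.aestronglyMeasurable ?_)
    fun_prop
  have hle : ∀ y, ∀ v ∈ Metric.ball w 1,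
      ‖a y • (-(1 / (2 * s)) * heatKernel d s (v - y)) • innerSL ℝ (v - y)‖ ≤
        A * (Real.exp (-(c / 2) * ‖y‖ ^ 2) * |a y|) := by
    intro y v hv
    have h0 := heatKernel_nonneg hs.le (v - y)
    rw [norm_smul, norm_smul, innerSL_apply_norm, Real.norm_eq_abs, Real.norm_eq_abs, abs_mul,
      abs_neg, abs_of_nonneg h0, abs_of_pos (by positivity : 0 < 1 / (2 * s))]
    calc _ = |a y| * (1 / (2 * s) * (‖v - y‖ * heatKernel d s (v - y))) := by ring
      _ ≤ |a y| * (1 / (2 * s) * (C * (Real.exp (c * (‖w‖ + 1) ^ 2) *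
          Real.exp (-(c / 2) * ‖y‖ ^ 2)))) := by
        gcongr |a y| * (_ * ?_)
        refine ((hC (v - y)).2).trans ?_
        gcongr
        exact hgauss v hv y
      _ = _ := by rw [hA]; ring
  have hw : w ∈ Metric.ball w 1 := Metric.mem_ball_self one_pos
  refine ⟨hbound.mono' hmeas (.of_forall fun y => hle y w hw), ?_⟩
  refine hasFDerivAt_integral_of_dominated_of_fderiv_le (𝕜 := ℝ)
    (F := fun v y => heatKernel d s (v - y) * a y)
    (F' := fun v y => a y • (-(1 / (2 * s)) * heatKernel d s (v - y)) • innerSL ℝ (v - y))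
    (Metric.ball_mem_nhds w one_pos) (.of_forall fun v => ?_) ?_ hmeas
    (.of_forall hle) hbound (.of_forall fun y v _ => ?_)
  · have := (continuous_heatKernel (d := d) s).measurable
    fun_prop
  · have := (continuous_heatKernel (d := d) s).measurable
    refine ((ha.integrable_exp_mul_abs (c := c / 2) (by positivity)).const_mul
      (C * Real.exp (c * (‖w‖ + 1) ^ 2))).mono' (by fun_prop) (.of_forall fun y => ?_)
    have h0 := heatKernel_nonneg hs.le (w - y)
    rw [Real.norm_eq_abs, abs_mul, abs_of_nonneg h0, ← mul_assoc, mul_assoc C]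
    gcongr
    refine ((hC (w - y)).1).trans ?_
    gcongr
    exact hgauss w hw y
  · have h1 := (hasFDerivAt_heatKernel s (v - y)).comp v ((hasFDerivAt_id v).sub_const y)
    exact h1.mul_const (a y)

lemma pd_heat (ha : GaussianSqIntegrable a) (hs : 0 < s) (j : Fin d)
    (w : EuclideanSpace ℝ (Fin d)) :
    pd j (heat d s a) w =
      ∫ y, -(1 / (2 * s)) * ((w - y) j * (heatKernel d s (w - y) * a y)) := by
  obtain ⟨hi, hd⟩ := hasFDerivAt_heat ha hs w
  rw [pd, hd.fderiv, ContinuousLinearMap.integral_apply hi]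
  congr 1 with y
  simp [EuclideanSpace.inner_single_right]
  ring

lemma integrable_coord_mul_heatKernel (ha : GaussianSqIntegrable a) (hs : 0 < s) (j : Fin d)
    (w : EuclideanSpace ℝ (Fin d)) :
    Integrable fun y => -(1 / (2 * s)) * ((w - y) j * (heatKernel d s (w - y) * a y)) := by
  have hi := (hasFDerivAt_heat ha hs w).1.apply_continuousLinearMap (EuclideanSpace.single j 1)
  refine hi.congr (.of_forall fun y => ?_)
  simp [EuclideanSpace.inner_single_right]
  ring

lemma sum_pd_heat_mul_pd_heat (ha : GaussianSqIntegrable a) (hb : GaussianSqIntegrable b)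
    (hs : 0 < s) (w : EuclideanSpace ℝ (Fin d)) :
    ∑ j, pd j (heat d s a) w * pd j (heat d s b) w =
      ∫ p : EuclideanSpace ℝ (Fin d) × EuclideanSpace ℝ (Fin d),
        inner ℝ (w - p.1) (w - p.2) / (4 * s ^ 2) *
          (heatKernel d s (w - p.1) * heatKernel d s (w - p.2)) * (a p.1 * b p.2) := by
  simp_rw [pd_heat ha hs, pd_heat hb hs, ← integral_prod_mul]
  rw [← integral_finsetSum]
  · congr 1 with p
    simp only [PiLp.inner_apply, RCLike.inner_apply, conj_trivial]
    rw [Finset.sum_div, Finset.sum_mul, Finset.sum_mul]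
    refine Finset.sum_congr rfl fun j _ => ?_
    field_simp
    ring
  · exact fun j _ => (integrable_coord_mul_heatKernel ha hs j w).mul_prod
      (integrable_coord_mul_heatKernel hb hs j w)

end Gradient

section Fubini

variable {d : ℕ} {t s : ℝ} {a b : EuclideanSpace ℝ (Fin d) → ℝ}

lemma exp_mul_exp_mul_exp_le {c : ℝ} (hc : 0 ≤ c) (x w y z : EuclideanSpace ℝ (Fin d)) :
    Real.exp (-c * ‖x - w‖ ^ 2) * (Real.exp (-c * ‖w - y‖ ^ 2) * Real.exp (-c * ‖w - z‖ ^ 2)) ≤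
      Real.exp (c * ‖x‖ ^ 2) * (Real.exp (-(c / 16) * ‖w‖ ^ 2) *
        (Real.exp (-(c / 16) * ‖y‖ ^ 2) * Real.exp (-(c / 16) * ‖z‖ ^ 2))) := by
  simp only [← Real.exp_add, Real.exp_le_exp]
  have h : ∀ u v : EuclideanSpace ℝ (Fin d), ‖v‖ ^ 2 ≤ 2 * ‖u‖ ^ 2 + 2 * ‖u - v‖ ^ 2 := by
    intro u v
    have h2 : ‖v‖ ≤ ‖u‖ + ‖u - v‖ := by
      calc ‖v‖ = ‖u - (u - v)‖ := by congr 1; abel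
        _ ≤ _ := norm_sub_le _ _
    nlinarith [norm_nonneg v, norm_nonneg u, norm_nonneg (u - v), sq_nonneg (‖u‖ - ‖u - v‖)]
  have h1 : (‖w‖ ^ 2 + ‖y‖ ^ 2 + ‖z‖ ^ 2) / 16 ≤
      ‖x‖ ^ 2 + ‖x - w‖ ^ 2 + ‖w - y‖ ^ 2 + ‖w - z‖ ^ 2 := by
    linarith [h x w, h w y, h w z, sq_nonneg ‖w‖, sq_nonneg ‖w - y‖, sq_nonneg ‖w - z‖]
  nlinarith [mul_le_mul_of_nonneg_left h1 hc]

lemma integrable_heatKernel_mul_grad_mul_grad (ha : GaussianSqIntegrable a)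
    (hb : GaussianSqIntegrable b) (hs : 0 < s) (hst : s < t) (x : EuclideanSpace ℝ (Fin d)) :
    Integrable (fun q : EuclideanSpace ℝ (Fin d) ×
        (EuclideanSpace ℝ (Fin d) × EuclideanSpace ℝ (Fin d)) =>
      heatKernel d (t - s) (x - q.1) * (inner ℝ (q.1 - q.2.1) (q.1 - q.2.2) / (4 * s ^ 2) *
        (heatKernel d s (q.1 - q.2.1) * heatKernel d s (q.1 - q.2.2)) * (a q.2.1 * b q.2.2))) := by
  have hma := ha.measurable
  have hmb := hb.measurable
  have hτ : 0 < t - s := by linarith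
  obtain ⟨C, hC0, hC⟩ := exists_norm_mul_heatKernel_le d hs
  obtain ⟨C', hC0', hC'⟩ := exists_norm_mul_heatKernel_le d hτ
  set c : ℝ := min (1 / (8 * s)) (1 / (8 * (t - s))) with hc
  have hc0 : 0 < c := lt_min (by positivity) (by positivity)
  have hc1 : c ≤ 1 / (8 * s) := min_le_left _ _
  have hc2 : c ≤ 1 / (8 * (t - s)) := min_le_right _ _
  have hC1 : ∀ v : EuclideanSpace ℝ (Fin d),
      ‖v‖ * heatKernel d s v ≤ C * Real.exp (-c * ‖v‖ ^ 2) :=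
    fun v => (hC v).2.trans (by gcongr)
  have hC2 : ∀ v : EuclideanSpace ℝ (Fin d),
      heatKernel d (t - s) v ≤ C' * Real.exp (-c * ‖v‖ ^ 2) :=
    fun v => (hC' v).1.trans (by gcongr)
  have hbound := ((integrable_exp_neg_mul_norm_sq (d := d) (c := c / 16) (by positivity)).mul_prod
    ((ha.integrable_exp_mul_abs (c := c / 16) (by positivity)).mul_prod
      (hb.integrable_exp_mul_abs (c := c / 16) (by positivity)))).const_mul
    (C' * C ^ 2 / (4 * s ^ 2) * Real.exp (c * ‖x‖ ^ 2))
  have hk1 := (continuous_heatKernel (d := d) s).measurable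
  have hk2 := (continuous_heatKernel (d := d) (t - s)).measurable
  refine hbound.mono' (Measurable.aestronglyMeasurable (by fun_prop)) (.of_forall ?_)
  rintro ⟨w, y, z⟩
  have hy := heatKernel_nonneg hs.le (w - y)
  have hz := heatKernel_nonneg hs.le (w - z)
  have hx := heatKernel_nonneg hτ.le (x - w)
  simp only [Real.norm_eq_abs, abs_mul, abs_div, abs_of_nonneg hy, abs_of_nonneg hz,
    abs_of_nonneg hx, abs_of_pos (by positivity : 0 < 4 * s ^ 2)]
  have h1 := abs_real_inner_le_norm (w - y) (w - z)
  calc _ ≤ heatKernel d (t - s) (x - w) * (‖w - y‖ * ‖w - z‖ / (4 * s ^ 2) *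
        (heatKernel d s (w - y) * heatKernel d s (w - z)) * (|a y| * |b z|)) := by gcongr
    _ = heatKernel d (t - s) (x - w) * ((‖w - y‖ * heatKernel d s (w - y)) *
        (‖w - z‖ * heatKernel d s (w - z))) * (1 / (4 * s ^ 2) * (|a y| * |b z|)) := by ring
    _ ≤ (C' * Real.exp (-c * ‖x - w‖ ^ 2)) * ((C * Real.exp (-c * ‖w - y‖ ^ 2)) *
        (C * Real.exp (-c * ‖w - z‖ ^ 2))) * (1 / (4 * s ^ 2) * (|a y| * |b z|)) := by
      refine mul_le_mul_of_nonneg_right ?_ (by positivity)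
      exact mul_le_mul (hC2 _) (mul_le_mul (hC1 _) (hC1 _) (by positivity) (by positivity))
        (by positivity) (by positivity)
    _ = (C' * C ^ 2 / (4 * s ^ 2) * (|a y| * |b z|)) * (Real.exp (-c * ‖x - w‖ ^ 2) *
        (Real.exp (-c * ‖w - y‖ ^ 2) * Real.exp (-c * ‖w - z‖ ^ 2))) := by ring
    _ ≤ (C' * C ^ 2 / (4 * s ^ 2) * (|a y| * |b z|)) * (Real.exp (c * ‖x‖ ^ 2) *
        (Real.exp (-(c / 16) * ‖w‖ ^ 2) *
          (Real.exp (-(c / 16) * ‖y‖ ^ 2) * Real.exp (-(c / 16) * ‖z‖ ^ 2)))) := by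
      gcongr (_ * ?_)
      exact exp_mul_exp_mul_exp_le hc0.le x w y z
    _ = _ := by ring

/-- The heat flow of `∇e^{sΔ}a · ∇e^{sΔ}b` in terms of the two-point kernel. -/
lemma heat_sum_pd_heat_mul_pd_heat (ha : GaussianSqIntegrable a)
    (hb : GaussianSqIntegrable b) (hs : 0 < s) (hst : s < t) (x : EuclideanSpace ℝ (Fin d)) :
    heat d (t - s) (fun w => ∑ j, pd j (heat d s a) w * pd j (heat d s b) w) x =
      -(1 / 2) * ∫ p, twoPointKernelDeriv d t x s p * (a p.1 * b p.2) := by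
  unfold heat
  have h0 := sum_pd_heat_mul_pd_heat ha hb hs
  unfold heat at h0
  simp_rw [h0, ← integral_const_mul]
  rw [integral_integral_swap (integrable_heatKernel_mul_grad_mul_grad ha hb hs hst x)]
  congr 1 with p
  have h := integral_heatKernel_mul_grad_mul_grad hs hst x p.1 p.2
  rw [← mul_assoc, ← h, ← integral_mul_const]
  congr 1 with w
  ring

end Fubini

section Marginals

variable {d : ℕ} {t s : ℝ} {a : EuclideanSpace ℝ (Fin d) → ℝ}

lemma heatKernel_eq_two_pow_mul (ht : 0 ≤ t) (u : EuclideanSpace ℝ (Fin d)) :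
    heatKernel d t u = 2 ^ d * heatKernel d (4 * t) ((2 : ℝ) • u) := by
  unfold heatKernel
  have e1 : 4 * Real.pi * (4 * t) = 4 * (4 * Real.pi * t) := by ring
  have e2 : (2 : ℝ) ^ d * (4 : ℝ) ^ (-(d : ℝ) / 2) = 1 := by
    have : (4 : ℝ) = 2 ^ (2 : ℝ) := by norm_num
    rw [this, ← Real.rpow_mul (by norm_num), ← Real.rpow_natCast, ← Real.rpow_add (by norm_num)]
    have : (d : ℝ) + 2 * (-(d : ℝ) / 2) = 0 := by ring
    rw [this, Real.rpow_zero]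
  have e3 : -‖(2 : ℝ) • u‖ ^ 2 / (4 * (4 * t)) = -‖u‖ ^ 2 / (4 * t) := by
    rw [norm_smul, mul_pow]
    norm_num
    rw [neg_mul_eq_mul_neg, mul_div_mul_left _ _ (by norm_num)]
  rw [e1, Real.mul_rpow (x := 4) (y := 4 * Real.pi * t) (by norm_num) (by positivity), e3,
    ← mul_assoc, ← mul_assoc, e2, one_mul]

/-- The marginal of the two-point kernel is the heat kernel at time `t`. -/
lemma integral_twoPointKernel_right (hs : 0 < s) (hst : s < 2 * t)
    (x y : EuclideanSpace ℝ (Fin d)) :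
    ∫ z, twoPointKernel d t x s (y, z) = heatKernel d t (x - y) := by
  rw [← integral_add_right_eq_self _ y]
  have e : ∀ z : EuclideanSpace ℝ (Fin d), twoPointKernel d t x s (y, z + y) =
      2 ^ d * (heatKernel d (4 * (t - s / 2)) ((2 : ℝ) • (x - y) - z) * heatKernel d (2 * s) z) := by
    intro z
    simp only [twoPointKernel]
    rw [heatKernel_eq_two_pow_mul (by linarith), heatKernel_sub_comm _ y, add_sub_cancel_right,
      mul_assoc]
    congr 4
    module
  simp_rw [e]
  rw [integral_const_mul, integral_heatKernel_mul_heatKernel (by linarith) (by linarith),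
    heatKernel_eq_two_pow_mul (by linarith) (x - y)]
  congr 3
  ring

lemma integrable_twoPointKernel_mul (hs : 0 < s) (hst : s < 2 * t)
    (x : EuclideanSpace ℝ (Fin d)) {f g : EuclideanSpace ℝ (Fin d) → ℝ} (hf : Measurable f)
    (hg : Measurable g)
    (hfi : ∀ c : ℝ, 0 < c → Integrable (fun y => Real.exp (-c * ‖y‖ ^ 2) * |f y|))
    (hgi : ∀ c : ℝ, 0 < c → Integrable (fun y => Real.exp (-c * ‖y‖ ^ 2) * |g y|)) :
    Integrable (fun p => twoPointKernel d t x s p * (f p.1 * g p.2)) := by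
  obtain ⟨R, hsR, hRt⟩ := exists_between hst
  obtain ⟨C, c, hc, hC⟩ := exists_twoPointKernel_le (r := s) (by linarith : 0 < t) x hs hRt
  exact integrable_of_abs_le_exp_mul_exp continuous_twoPointKernel hf hg (hfi c hc) (hgi c hc)
    fun y z => (hC s ⟨le_rfl, hsR.le⟩ y z).1

lemma integrable_twoPointKernel_mul_fst (hs : 0 < s) (hst : s < 2 * t)
    (x : EuclideanSpace ℝ (Fin d)) {f : EuclideanSpace ℝ (Fin d) → ℝ} (hf : Measurable f)
    (hfi : ∀ c : ℝ, 0 < c → Integrable (fun y => Real.exp (-c * ‖y‖ ^ 2) * |f y|)) :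
    Integrable (fun p => twoPointKernel d t x s p * f p.1) := by
  simpa using integrable_twoPointKernel_mul hs hst x hf (measurable_const (a := (1 : ℝ))) hfi
    (fun c hc => by simpa using integrable_exp_neg_mul_norm_sq hc)

lemma integral_twoPointKernel_mul_fst (hs : 0 < s) (hst : s < 2 * t)
    (x : EuclideanSpace ℝ (Fin d)) {f : EuclideanSpace ℝ (Fin d) → ℝ} (hf : Measurable f)
    (hfi : ∀ c : ℝ, 0 < c → Integrable (fun y => Real.exp (-c * ‖y‖ ^ 2) * |f y|)) :
    ∫ p, twoPointKernel d t x s p * f p.1 = heat d t f x := by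
  rw [Measure.volume_eq_prod,
    integral_prod _ (integrable_twoPointKernel_mul_fst hs hst x hf hfi), heat]
  congr 1 with y
  simp only
  rw [integral_mul_const, integral_twoPointKernel_right hs hst]

lemma integrable_twoPointKernel_mul_snd (hs : 0 < s) (hst : s < 2 * t)
    (x : EuclideanSpace ℝ (Fin d)) {f : EuclideanSpace ℝ (Fin d) → ℝ} (hf : Measurable f)
    (hfi : ∀ c : ℝ, 0 < c → Integrable (fun y => Real.exp (-c * ‖y‖ ^ 2) * |f y|)) :
    Integrable (fun p => twoPointKernel d t x s p * f p.2) := by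
  refine (integrable_twoPointKernel_mul_fst hs hst x hf hfi).swap.congr (.of_forall fun p => ?_)
  simp only [Function.comp_apply, Prod.fst_swap]
  rw [← twoPointKernel_swap, Prod.swap]

lemma integral_twoPointKernel_mul_snd (hs : 0 < s) (hst : s < 2 * t)
    (x : EuclideanSpace ℝ (Fin d)) {f : EuclideanSpace ℝ (Fin d) → ℝ} (hf : Measurable f)
    (hfi : ∀ c : ℝ, 0 < c → Integrable (fun y => Real.exp (-c * ‖y‖ ^ 2) * |f y|)) :
    ∫ p, twoPointKernel d t x s p * f p.2 = heat d t f x := by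
  rw [← integral_twoPointKernel_mul_fst hs hst x hf hfi, Measure.volume_eq_prod,
    ← integral_prod_swap]
  congr 1 with p
  simp only [Prod.snd_swap]
  rw [Prod.swap, ← twoPointKernel_swap]

lemma integrable_and_integral_twoPointKernel (hs : 0 < s) (hst : s < 2 * t)
    (x : EuclideanSpace ℝ (Fin d)) :
    Integrable (twoPointKernel d t x s) ∧ ∫ p, twoPointKernel d t x s p = 1 := by
  have h1 : ∀ c : ℝ, 0 < c → Integrable (fun y : EuclideanSpace ℝ (Fin d) =>
      Real.exp (-c * ‖y‖ ^ 2) * |(1 : ℝ)|) :=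
    fun c hc => by simpa using integrable_exp_neg_mul_norm_sq hc
  refine ⟨by simpa using integrable_twoPointKernel_mul_fst hs hst x measurable_const h1, ?_⟩
  have h2 := integral_twoPointKernel_mul_fst hs hst x measurable_const h1
  simp only [mul_one, heat] at h2
  rw [h2, integral_sub_left_eq_self (heatKernel d t), integral_heatKernel (by linarith)]

lemma GaussianSqIntegrable.integrable_exp_mul_abs_sq (ha : GaussianSqIntegrable a) (c : ℝ)
    (hc : 0 < c) : Integrable (fun y => Real.exp (-c * ‖y‖ ^ 2) * |a y ^ 2|) := by
  simpa using ha.integrable c hc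

/-- The bilinear form on the diagonal, in terms of squared differences. -/
lemma integral_twoPointKernel_mul_self (ha : GaussianSqIntegrable a) (hs : 0 < s)
    (hst : s < 2 * t) (x : EuclideanSpace ℝ (Fin d)) :
    Integrable (fun p => twoPointKernel d t x s p * (a p.1 - a p.2) ^ 2) ∧
    ∫ p, twoPointKernel d t x s p * (a p.1 * a p.2) = heat d t (fun y => a y ^ 2) x -
      1 / 2 * ∫ p, twoPointKernel d t x s p * (a p.1 - a p.2) ^ 2 := by
  have hma := ha.measurable
  have hm2 : Measurable fun y => a y ^ 2 := by fun_prop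
  have i1 := integrable_twoPointKernel_mul_fst hs hst x hm2 ha.integrable_exp_mul_abs_sq
  have i2 := integrable_twoPointKernel_mul_snd hs hst x hm2 ha.integrable_exp_mul_abs_sq
  have v1 := integral_twoPointKernel_mul_fst hs hst x hm2 ha.integrable_exp_mul_abs_sq
  have v2 := integral_twoPointKernel_mul_snd hs hst x hm2 ha.integrable_exp_mul_abs_sq
  have i3 := integrable_twoPointKernel_mul hs hst x hma hma
    (fun c hc => ha.integrable_exp_mul_abs hc) (fun c hc => ha.integrable_exp_mul_abs hc)
  have e : ∀ p : EuclideanSpace ℝ (Fin d) × EuclideanSpace ℝ (Fin d),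
      twoPointKernel d t x s p * (a p.1 - a p.2) ^ 2 = twoPointKernel d t x s p * a p.1 ^ 2 +
        twoPointKernel d t x s p * a p.2 ^ 2 -
          2 * (twoPointKernel d t x s p * (a p.1 * a p.2)) := by
    intro p; ring
  simp_rw [e]
  refine ⟨(i1.add i2).sub (i3.const_mul 2), ?_⟩
  rw [integral_sub (by exact i1.add i2) (i3.const_mul 2), integral_add i1 i2, v1, v2,
    integral_const_mul]
  ring

lemma integral_twoPointKernel_mul_sub_sq_le (ha : GaussianSqIntegrable a) (hs : 0 < s)
    (hst : s < 2 * t) (x : EuclideanSpace ℝ (Fin d)) :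
    ∫ p, twoPointKernel d t x s p * (a p.1 - a p.2) ^ 2 ≤
      4 * heat d t (fun y => a y ^ 2) x := by
  have hma := ha.measurable
  have hm2 : Measurable fun y => a y ^ 2 := by fun_prop
  have i1 := integrable_twoPointKernel_mul_fst hs hst x hm2 ha.integrable_exp_mul_abs_sq
  have i2 := integrable_twoPointKernel_mul_snd hs hst x hm2 ha.integrable_exp_mul_abs_sq
  have v1 := integral_twoPointKernel_mul_fst hs hst x hm2 ha.integrable_exp_mul_abs_sq
  have v2 := integral_twoPointKernel_mul_snd hs hst x hm2 ha.integrable_exp_mul_abs_sq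
  calc _ ≤ ∫ p, (2 * (twoPointKernel d t x s p * a p.1 ^ 2) +
        2 * (twoPointKernel d t x s p * a p.2 ^ 2)) := by
        refine integral_mono (integral_twoPointKernel_mul_self ha hs hst x).1
          ((i1.const_mul 2).add (i2.const_mul 2)) fun p => ?_
        have h0 := twoPointKernel_nonneg (x := x) hs.le hst.le p
        nlinarith [mul_nonneg h0 (sq_nonneg (a p.1 + a p.2))]
    _ = _ := by
      rw [integral_add (i1.const_mul 2) (i2.const_mul 2), integral_const_mul, integral_const_mul,
        v1, v2]
      ring

lemma twoPointKernel_mul_norm_sq_le (hs : 0 < s) (hst : s < 2 * t)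
    (x y z : EuclideanSpace ℝ (Fin d)) :
    twoPointKernel d t x s (y, z) * ‖y - z‖ ^ 2 ≤
      2 ^ ((d : ℝ) / 2) * 16 * s * twoPointKernel d (t + s / 2) x (2 * s) (y, z) := by
  simp only [twoPointKernel]
  have e1 : t + s / 2 - 2 * s / 2 = t - s / 2 := by ring
  rw [e1]
  have h0 := heatKernel_nonneg (by linarith : 0 ≤ t - s / 2) (x - (1 / 2 : ℝ) • (y + z))
  suffices h : heatKernel d (2 * s) (y - z) * ‖y - z‖ ^ 2 ≤
      2 ^ ((d : ℝ) / 2) * 16 * s * heatKernel d (2 * (2 * s)) (y - z) by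
    have := mul_le_mul_of_nonneg_left h h0
    linarith
  rw [heatKernel_eq, heatKernel_eq]
  have h1 := mul_exp_neg_mul_le (c := 1 / (4 * (2 * s))) (by positivity) (‖y - z‖ ^ 2)
  have e2 : (2 : ℝ) ^ ((d : ℝ) / 2) * (4 * Real.pi * (2 * (2 * s))) ^ (-(d : ℝ) / 2) =
      (4 * Real.pi * (2 * s)) ^ (-(d : ℝ) / 2) := by
    have : 4 * Real.pi * (2 * (2 * s)) = 2 * (4 * Real.pi * (2 * s)) := by ring
    rw [this, Real.mul_rpow (x := 2) (y := 4 * Real.pi * (2 * s)) (by norm_num) (by positivity),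
      ← mul_assoc, ← Real.rpow_add (by norm_num), neg_div, add_neg_cancel, Real.rpow_zero, one_mul]
  have e3 : 1 / (4 * (2 * s)) / 2 = 1 / (4 * (2 * (2 * s))) := by field_simp
  have e4 : 2 / (1 / (4 * (2 * s))) = 16 * s := by field_simp; norm_num
  rw [e3, e4] at h1
  have h2 := mul_le_mul_of_nonneg_left h1
    (by positivity : 0 ≤ (4 * Real.pi * (2 * s)) ^ (-(d : ℝ) / 2))
  refine le_trans (le_of_eq (by ring)) (h2.trans (le_of_eq ?_))
  rw [← e2]
  ring

lemma tendsto_integral_twoPointKernel_mul_sub_sq (ht : 0 < t) (x : EuclideanSpace ℝ (Fin d))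
    (hc : Continuous a) (hcs : HasCompactSupport a) {ε : ℝ} (hε : 0 < ε) :
    ∀ᶠ s in 𝓝[>] 0, ∫ p, twoPointKernel d t x s p * (a p.1 - a p.2) ^ 2 ≤ ε := by
  obtain ⟨B, hB⟩ := hcs.exists_bound_of_continuous hc
  have ha : GaussianSqIntegrable a := .of_continuous_of_bounded hc hB
  have hB0 : 0 ≤ B := (norm_nonneg _).trans (hB 0)
  obtain ⟨δ, hδ, hδa⟩ := Metric.uniformContinuous_iff.1 (hcs.uniformContinuous_of_continuous hc)
    (Real.sqrt (ε / 2)) (by positivity)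
  have hpt : ∀ y z, (a y - a z) ^ 2 ≤ ε / 2 + 4 * B ^ 2 / δ ^ 2 * ‖y - z‖ ^ 2 := by
    intro y z
    rcases lt_or_ge ‖y - z‖ δ with h | h
    · have h1 := hδa (a := y) (b := z) (by rwa [dist_eq_norm])
      rw [Real.dist_eq] at h1
      have h2 : (a y - a z) ^ 2 ≤ ε / 2 := by
        rw [← sq_abs, ← Real.sq_sqrt (by positivity : 0 ≤ ε / 2)]
        gcongr
      have : 0 ≤ 4 * B ^ 2 / δ ^ 2 * ‖y - z‖ ^ 2 := by positivity
      linarith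
    · have h1 : |a y - a z| ≤ 2 * B := by
        have := abs_sub (a y) (a z)
        have := hB y
        have := hB z
        simp only [Real.norm_eq_abs] at *
        linarith
      have h2 : (a y - a z) ^ 2 ≤ 4 * B ^ 2 := by
        rw [← sq_abs]
        nlinarith [abs_nonneg (a y - a z)]
      have h3 : 1 ≤ ‖y - z‖ ^ 2 / δ ^ 2 := by
        rw [one_le_div (by positivity)]
        gcongr
      have h4 : 4 * B ^ 2 / δ ^ 2 * ‖y - z‖ ^ 2 = 4 * B ^ 2 * (‖y - z‖ ^ 2 / δ ^ 2) := by ring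
      nlinarith [sq_nonneg B]
  set A : ℝ := 4 * B ^ 2 / δ ^ 2 * (2 ^ ((d : ℝ) / 2) * 16) with hA
  have hlim : Tendsto (fun s : ℝ => ε / 2 + A * s) (𝓝[>] 0) (𝓝 (ε / 2 + A * 0)) :=
    ((continuous_const.add (continuous_const.mul continuous_id)).tendsto 0).mono_left
      nhdsWithin_le_nhds
  have hev := hlim.eventually_le_const (by linarith : ε / 2 + A * 0 < ε)
  filter_upwards [hev, Ioo_mem_nhdsGT (by linarith : (0 : ℝ) < 2 * t)] with s hs1 hs2
  obtain ⟨hs, hst⟩ := hs2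
  obtain ⟨i1, v1⟩ := integrable_and_integral_twoPointKernel hs hst x
  obtain ⟨i2, v2⟩ := integrable_and_integral_twoPointKernel (t := t + s / 2) (s := 2 * s)
    (by positivity) (by linarith) x
  refine le_trans ?_ hs1
  calc _ ≤ ∫ p, (ε / 2 * twoPointKernel d t x s p +
        A * s * twoPointKernel d (t + s / 2) x (2 * s) p) := by
        refine integral_mono (integral_twoPointKernel_mul_self ha hs hst x).1
          ((i1.const_mul _).add (i2.const_mul _)) fun p => ?_
        have h0 := twoPointKernel_nonneg (x := x) hs.le hst.le p
        have h1 := mul_le_mul_of_nonneg_left (hpt p.1 p.2) h0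
        have h2 := mul_le_mul_of_nonneg_left (twoPointKernel_mul_norm_sq_le hs hst x p.1 p.2)
          (by positivity : 0 ≤ 4 * B ^ 2 / δ ^ 2)
        simp only [Prod.mk.eta] at h2
        refine h1.trans (le_trans (le_of_eq ?_) (add_le_add le_rfl (h2.trans (le_of_eq ?_))))
        · ring
        · rw [hA]; ring
    _ = _ := by
      rw [integral_add (i1.const_mul _) (i2.const_mul _), integral_const_mul, integral_const_mul,
        v1, v2]
      ring

lemma integrable_heatKernel_mul (ht : 0 < t) (x : EuclideanSpace ℝ (Fin d))
    {f : EuclideanSpace ℝ (Fin d) → ℝ} (hf : Measurable f)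
    (hfi : ∀ c : ℝ, 0 < c → Integrable (fun y => Real.exp (-c * ‖y‖ ^ 2) * |f y|)) :
    Integrable fun y => heatKernel d t (x - y) * f y := by
  have hk := (continuous_heatKernel (d := d) t).measurable
  obtain ⟨C, hC0, hC⟩ := exists_norm_mul_heatKernel_le d ht
  refine ((hfi (1 / (8 * t) / 2) (by positivity)).const_mul
    (C * Real.exp (1 / (8 * t) * ‖x‖ ^ 2))).mono' (by fun_prop) (.of_forall fun y => ?_)
  have h0 := heatKernel_nonneg ht.le (x - y)
  rw [Real.norm_eq_abs, abs_mul, abs_of_nonneg h0, ← mul_assoc, mul_assoc C]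
  gcongr
  refine (hC (x - y)).1.trans ?_
  gcongr
  exact exp_neg_mul_norm_sub_sq_le (by positivity) x y

/-- Continuous compactly supported functions are dense in `L²(g_t(x - y) dy)`. -/
lemma exists_continuous_heat_sub_sq_le (ha : GaussianSqIntegrable a) (ht : 0 < t)
    (x : EuclideanSpace ℝ (Fin d)) {ε : ℝ} (hε : 0 < ε) :
    ∃ f : EuclideanSpace ℝ (Fin d) → ℝ, HasCompactSupport f ∧ Continuous f ∧
      heat d t (fun y => (a y - f y) ^ 2) x ≤ ε := by
  have hma := ha.measurable
  have hkm : Measurable fun y => heatKernel d t (x - y) :=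
    (continuous_heatKernel (d := d) t).measurable.comp (by fun_prop)
  have hk0 : ∀ y, 0 ≤ heatKernel d t (x - y) := fun y => heatKernel_nonneg ht.le _
  have hki : Integrable fun y => heatKernel d t (x - y) :=
    (integrable_heatKernel ht).comp_sub_left x
  have hi : Integrable fun y => heatKernel d t (x - y) * a y ^ 2 :=
    integrable_heatKernel_mul ht x (by fun_prop) ha.integrable_exp_mul_abs_sq
  set μ : Measure (EuclideanSpace ℝ (Fin d)) :=
    volume.withDensity fun y => ENNReal.ofReal (heatKernel d t (x - y)) with hμ
  have hfin : IsFiniteMeasure μ := isFiniteMeasure_withDensity_ofReal hki.2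
  have hmem : MemLp a (ENNReal.ofReal 2) μ := by
    rw [show ENNReal.ofReal 2 = 2 by norm_num, memLp_two_iff_integrable_sq (by fun_prop), hμ,
      integrable_withDensity_iff_integrable_smul' (by fun_prop) (by simp)]
    refine hi.congr (.of_forall fun y => ?_)
    simp [ENNReal.toReal_ofReal (hk0 y)]
  obtain ⟨f, hfs, hf, hfc, -⟩ :=
    hmem.exists_hasCompactSupport_integral_rpow_sub_le (by norm_num) hε
  refine ⟨f, hfs, hfc, le_trans (le_of_eq ?_) hf⟩
  rw [hμ, integral_withDensity_eq_integral_toReal_smul (by fun_prop) (by simp), heat]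
  congr 1 with y
  simp [ENNReal.toReal_ofReal (hk0 y)]

/-- The quadratic form tends to `e^{tΔ}(a²)` as `s → 0`. -/
lemma tendsto_integral_twoPointKernel (ha : GaussianSqIntegrable a) (ht : 0 < t)
    (x : EuclideanSpace ℝ (Fin d)) :
    Tendsto (fun s => ∫ p, twoPointKernel d t x s p * (a p.1 * a p.2)) (𝓝[>] 0)
      (𝓝 (heat d t (fun y => a y ^ 2) x)) := by
  rw [Metric.tendsto_nhds]
  intro ε hε
  obtain ⟨f, hfs, hfc, hf⟩ := exists_continuous_heat_sub_sq_le ha ht x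
    (by positivity : 0 < ε / 12)
  obtain ⟨B, hB⟩ := hfs.exists_bound_of_continuous hfc
  have hfg : GaussianSqIntegrable f := .of_continuous_of_bounded hfc hB
  filter_upwards [tendsto_integral_twoPointKernel_mul_sub_sq ht x hfc hfs
    (by positivity : 0 < ε / 3), Ioo_mem_nhdsGT (by linarith : (0 : ℝ) < 2 * t)] with s hs1 hs2
  obtain ⟨hs, hst⟩ := hs2
  obtain ⟨ia, va⟩ := integral_twoPointKernel_mul_self ha hs hst x
  have i1 := (integral_twoPointKernel_mul_self (ha.sub hfg) hs hst x).1
  have i2 := (integral_twoPointKernel_mul_self hfg hs hst x).1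
  have h1 := integral_twoPointKernel_mul_sub_sq_le (ha.sub hfg) hs hst x
  have h2 : ∫ p, twoPointKernel d t x s p * (a p.1 - a p.2) ^ 2 ≤
      ∫ p, (2 * (twoPointKernel d t x s p * (a p.1 - f p.1 - (a p.2 - f p.2)) ^ 2) +
        2 * (twoPointKernel d t x s p * (f p.1 - f p.2) ^ 2)) := by
    refine integral_mono ia ((i1.const_mul 2).add (i2.const_mul 2)) fun p => ?_
    have h0 := twoPointKernel_nonneg (x := x) hs.le hst.le p
    nlinarith [mul_nonneg h0 (sq_nonneg (a p.1 - f p.1 - (a p.2 - f p.2) - (f p.1 - f p.2)))]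
  rw [integral_add (i1.const_mul 2) (i2.const_mul 2), integral_const_mul,
    integral_const_mul] at h2
  have h3 : 0 ≤ ∫ p, twoPointKernel d t x s p * (a p.1 - a p.2) ^ 2 :=
    integral_nonneg fun p =>
      mul_nonneg (twoPointKernel_nonneg (x := x) hs.le hst.le p) (sq_nonneg _)
  rw [Real.dist_eq, va, abs_lt]
  constructor <;> linarith

end Marginals

section Duhamel

variable {d : ℕ} {t : ℝ} {a b : EuclideanSpace ℝ (Fin d) → ℝ}

/-- The identity on the diagonal, with integrability of the integrand. -/
lemma heat_sq_eq (ha : GaussianSqIntegrable a) (ht : 0 < t) (x : EuclideanSpace ℝ (Fin d)) :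
    IntegrableOn (fun s => heat d (t - s)
        (fun y => ∑ j, pd j (heat d s a) y * pd j (heat d s a) y) x) (Ioo 0 t) ∧
    heat d t a x * heat d t a x = heat d t (fun y => a y ^ 2) x -
      2 * ∫ s in Ioo 0 t, heat d (t - s)
        (fun y => ∑ j, pd j (heat d s a) y * pd j (heat d s a) y) x := by
  set J : ℝ → ℝ := fun s => heat d (t - s)
        (fun y => ∑ j, pd j (heat d s a) y * pd j (heat d s a) y) x with hJ
  set F : ℝ → ℝ := fun s => ∫ p, twoPointKernel d t x s p * (a p.1 * a p.2) with hF
  set G : ℝ → ℝ := Function.update F 0 (heat d t (fun y => a y ^ 2) x) with hG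
  have hGF : ∀ s, 0 < s → G =ᶠ[𝓝 s] F := by
    intro s hs
    filter_upwards [lt_mem_nhds hs] with r hr
    exact Function.update_of_ne hr.ne' _ _
  have hFd : ∀ s, 0 < s → s < 2 * t → HasDerivAt G
      (∫ p, twoPointKernelDeriv d t x s p * (a p.1 * a p.2)) s := fun s hs hst =>
    (hasDerivAt_integral_twoPointKernel ha ha x hs hst).2.congr_of_eventuallyEq (hGF s hs)
  have hd : ∀ s ∈ Ioo 0 t, HasDerivAt (fun r => -G r) (2 * J s) s := by
    intro s hs
    refine (hFd s hs.1 (by linarith [hs.2])).neg.congr_deriv ?_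
    rw [hJ]
    simp only
    rw [heat_sum_pd_heat_mul_pd_heat ha ha hs.1 hs.2]
    ring
  have hcont : ContinuousOn (fun r => -G r) (Icc 0 t) := by
    refine ContinuousOn.neg fun s hs => ?_
    rcases hs.1.eq_or_lt with rfl | hs0
    · rw [hG, continuousWithinAt_update_same]
      refine (tendsto_integral_twoPointKernel ha ht x).mono_left (nhdsWithin_mono _ ?_)
      exact fun r hr => lt_of_le_of_ne hr.1.1 (Ne.symm hr.2)
    · exact (hFd s hs0 (by linarith [hs.2])).continuousAt.continuousWithinAt
  have hpos : ∀ s ∈ Ioo 0 t, 0 ≤ 2 * J s := by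
    intro s hs
    refine mul_nonneg zero_le_two (integral_nonneg fun y => ?_)
    exact mul_nonneg (heatKernel_nonneg (by linarith [hs.2]) _)
      (Finset.sum_nonneg fun j _ => mul_self_nonneg _)
  have hJ2i : IntegrableOn (fun s => 2 * J s) (Ioc 0 t) :=
    intervalIntegral.integrableOn_deriv_of_nonneg hcont hd hpos
  have hJi : IntegrableOn J (Ioc 0 t) :=
    Integrable.congr (hJ2i.const_mul (1 / 2)) (.of_forall fun s => by ring)
  refine ⟨hJi.mono_set Ioo_subset_Ioc_self, ?_⟩
  have hv := intervalIntegral.integral_eq_sub_of_hasDerivAt_of_le ht.le hcont hd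
    ((intervalIntegrable_iff_integrableOn_Ioc_of_le ht.le).2 hJ2i)
  rw [intervalIntegral.integral_of_le ht.le, integral_const_mul, integral_Ioc_eq_integral_Ioo] at hv
  have hG0 : G 0 = heat d t (fun y => a y ^ 2) x := Function.update_self _ _ _
  have hGt : G t = heat d t a x * heat d t a x := by
    rw [hG, Function.update_of_ne ht.ne', hF]
    exact integral_twoPointKernel_self ht x
  rw [hG0, hGt] at hv
  linarith

lemma heat_mul_polarization (ha : GaussianSqIntegrable a) (hb : GaussianSqIntegrable b)
    (ht : 0 < t) (x : EuclideanSpace ℝ (Fin d)) :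
    heat d t (fun y => a y * b y) x = 1 / 4 * (heat d t (fun y => (a y + b y) ^ 2) x -
      heat d t (fun y => (a y - b y) ^ 2) x) := by
  have hma := ha.measurable
  have hmb := hb.measurable
  unfold heat
  rw [← integral_sub
    (integrable_heatKernel_mul ht x (by fun_prop) (ha.add hb).integrable_exp_mul_abs_sq)
    (integrable_heatKernel_mul ht x (by fun_prop) (ha.sub hb).integrable_exp_mul_abs_sq),
    ← integral_const_mul]
  congr 1 with y
  ring

lemma heat_sum_pd_polarization (ha : GaussianSqIntegrable a) (hb : GaussianSqIntegrable b)
    {s : ℝ} (hs : 0 < s) (hst : s < t) (x : EuclideanSpace ℝ (Fin d)) :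
    heat d (t - s) (fun y => ∑ j, pd j (heat d s a) y * pd j (heat d s b) y) x =
      1 / 4 * (heat d (t - s) (fun y => ∑ j, pd j (heat d s fun z => a z + b z) y *
          pd j (heat d s fun z => a z + b z) y) x -
        heat d (t - s) (fun y => ∑ j, pd j (heat d s fun z => a z - b z) y *
          pd j (heat d s fun z => a z - b z) y) x) := by
  have hst' : s < 2 * t := by linarith
  have hcomm : heat d (t - s) (fun y => ∑ j, pd j (heat d s a) y * pd j (heat d s b) y) x =
      heat d (t - s) (fun y => ∑ j, pd j (heat d s b) y * pd j (heat d s a) y) x := by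
    simp only [mul_comm]
  rw [heat_sum_pd_heat_mul_pd_heat ha hb hs hst, heat_sum_pd_heat_mul_pd_heat hb ha hs hst]
    at hcomm
  rw [heat_sum_pd_heat_mul_pd_heat ha hb hs hst,
    heat_sum_pd_heat_mul_pd_heat (ha.add hb) (ha.add hb) hs hst,
    heat_sum_pd_heat_mul_pd_heat (ha.sub hb) (ha.sub hb) hs hst]
  have h1 := integral_sub
    (hasDerivAt_integral_twoPointKernel (ha.add hb) (ha.add hb) x hs hst').1
    (hasDerivAt_integral_twoPointKernel (ha.sub hb) (ha.sub hb) x hs hst').1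
  have h2 := integral_add
    ((hasDerivAt_integral_twoPointKernel ha hb x hs hst').1.const_mul 2)
    ((hasDerivAt_integral_twoPointKernel hb ha x hs hst').1.const_mul 2)
  rw [integral_const_mul, integral_const_mul] at h2
  have h3 := integral_congr_ae (μ := volume) (.of_forall fun p => show
      twoPointKernelDeriv d t x s p * ((a p.1 + b p.1) * (a p.2 + b p.2)) -
        twoPointKernelDeriv d t x s p * ((a p.1 - b p.1) * (a p.2 - b p.2)) =
      2 * (twoPointKernelDeriv d t x s p * (a p.1 * b p.2)) +
        2 * (twoPointKernelDeriv d t x s p * (b p.1 * a p.2)) by ring)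
  linarith

end Duhamel

theorem stmt_15 (d : ℕ) (hd : 3 ≤ d) (a b : EuclideanSpace ℝ (Fin d) → ℝ) (M : ℝ)
    (hma : Measurable a) (hmb : Measurable b)
    (hab : ∀ x : EuclideanSpace ℝ (Fin d), x ≠ 0 → |a x| ≤ M * ‖x‖⁻¹)
    (hbb : ∀ x : EuclideanSpace ℝ (Fin d), x ≠ 0 → |b x| ≤ M * ‖x‖⁻¹)
    (t : ℝ) (ht : 0 < t) (x : EuclideanSpace ℝ (Fin d)) :
    heat d t a x * heat d t b x =
      heat d t (fun y => a y * b y) x -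
        2 * ∫ s in Set.Ioo (0 : ℝ) t,
          heat d (t - s)
            (fun y => ∑ j, pd j (heat d s a) y * pd j (heat d s b) y) x := by
  have ha : GaussianSqIntegrable a := .of_abs_le_inv_norm hd hma hab
  have hb : GaussianSqIntegrable b := .of_abs_le_inv_norm hd hmb hbb
  have ia := integrable_heatKernel_mul ht x hma fun c hc => ha.integrable_exp_mul_abs hc
  have ib := integrable_heatKernel_mul ht x hmb fun c hc => hb.integrable_exp_mul_abs hc
  have hadd : heat d t (fun y => a y + b y) x = heat d t a x + heat d t b x := by
    unfold heat
    rw [← integral_add ia ib]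
    simp only [mul_add]
  have hsub : heat d t (fun y => a y - b y) x = heat d t a x - heat d t b x := by
    unfold heat
    rw [← integral_sub ia ib]
    simp only [mul_sub]
  obtain ⟨i1, e1⟩ := heat_sq_eq (ha.add hb) ht x
  obtain ⟨i2, e2⟩ := heat_sq_eq (ha.sub hb) ht x
  rw [hadd] at e1
  rw [hsub] at e2
  rw [heat_mul_polarization ha hb ht, setIntegral_congr_fun measurableSet_Ioo
    fun s hs => heat_sum_pd_polarization ha hb hs.1 hs.2 x, integral_const_mul,
    integral_sub i1 i2]
  linear_combination (1 / 4) * e1 - (1 / 4) * e2
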